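/- For all rho in (0,1], mu >= 0, y > 0 and s > 0, (1/y) * integral over m in (0,y) of integral over b in (-infinity, m) of (y-b)^rho * exp(-mu*b - mu^2*s/2) * (2*(2m-b)/(s*sqrt(2*pi*s))) * exp(-(2m-b)^2/(2s)) db dm is at most 2*y^rho*(1/sqrt(2*pi*s) + mu) + 2*s^{(rho-1)/2}*(2 + mu^2*s). -/

import Mathlib

open MeasureTheory ProbabilityTheory Set
open scoped NNReal

theorem integrable_gaussianReal_iff {μ : ℝ} {v : ℝ≥0} (hv : v ≠ 0) {f : ℝ → ℝ} :
    Integrable f (gaussianReal μ v) ↔ Integrable fun x => gaussianPDFReal μ v x * f x := by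
  rw [gaussianReal_of_var_ne_zero μ hv, integrable_withDensity_iff_integrable_smul'
    (measurable_gaussianPDF μ v) (ae_of_all _ fun _ => gaussianPDF_lt_top)]
  simp [smul_eq_mul]

theorem integrable_sq_gaussianReal (μ : ℝ) (v : ℝ≥0) :
    Integrable (fun x => x ^ 2) (gaussianReal μ v) :=
  (memLp_id_gaussianReal' 2 (by simp)).integrable_sq

theorem integrable_id_gaussianReal (μ : ℝ) (v : ℝ≥0) :
    Integrable (fun x => x) (gaussianReal μ v) :=
  (memLp_id_gaussianReal' 1 (by simp)).integrable le_rfl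

theorem integral_sq_gaussianReal_zero (v : ℝ≥0) : ∫ x, x ^ 2 ∂gaussianReal 0 v = v := by
  have h := variance_fun_id_gaussianReal (μ := 0) (v := v)
  rw [variance_eq_integral (by fun_prop)] at h
  simpa using h

theorem integral_posPart_gaussianReal_zero {v : ℝ≥0} (hv : v ≠ 0) :
    ∫ x, max x 0 ∂gaussianReal 0 v = v / √(2 * Real.pi * v) := by
  have hv' : (0 : ℝ) < v := by positivity
  have h0 : ∀ x : ℝ, gaussianPDFReal 0 v x • max x 0 = (Ioi (0 : ℝ)).indicator
      (fun x => (√(2 * Real.pi * v))⁻¹ *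
        (x ^ (1 : ℝ) * Real.exp (-(1 / (2 * v)) * x ^ (2 : ℝ)))) x := by
    intro x
    by_cases hx : 0 < x
    · rw [indicator_of_mem (mem_Ioi.2 hx), max_eq_left hx.le, gaussianPDFReal]
      simp only [smul_eq_mul, sub_zero, Real.rpow_one, Real.rpow_two]
      rw [show -x ^ 2 / (2 * (v : ℝ)) = -(1 / (2 * v)) * x ^ 2 by ring]
      ring
    · rw [indicator_of_notMem (by simpa using hx), max_eq_right (not_lt.1 hx), smul_zero]
  rw [integral_gaussianReal_eq_integral_smul hv]
  simp_rw [h0]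
  rw [integral_indicator measurableSet_Ioi, integral_const_mul,
    integral_rpow_mul_exp_neg_mul_rpow two_pos (by norm_num) (by positivity)]
  norm_num [Real.rpow_neg_one]
  ring

/-- A dominating function, in the variable centred at the drift. -/
noncomputable def reflectionMajorant (ρ μ y s v : ℝ) : ℝ :=
  y ^ ρ * (2 / s) * (max v 0 + μ * s) + 2 * s ^ ((ρ - 1) / 2) * (1 + (v + μ * s) ^ 2 / s)

theorem reflectionMajorant_nonneg {ρ μ y s : ℝ} (hμ : 0 ≤ μ) (hy : 0 < y) (hs : 0 < s) (v : ℝ) :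
    0 ≤ reflectionMajorant ρ μ y s v := by
  unfold reflectionMajorant
  positivity

theorem integrable_reflectionMajorant (ρ μ y s : ℝ) (v : ℝ≥0) :
    Integrable (reflectionMajorant ρ μ y s) (gaussianReal 0 v) := by
  have h1 := integrable_id_gaussianReal 0 v
  have h2 := integrable_sq_gaussianReal 0 v
  have h3 : Integrable (fun x : ℝ => max x 0) (gaussianReal 0 v) := h1.pos_part
  have h4 : Integrable (fun x : ℝ => (x + μ * s) ^ 2) (gaussianReal 0 v) := by
    refine ((h2.add (h1.const_mul (2 * (μ * s)))).add (integrable_const ((μ * s) ^ 2))).congr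
      (ae_of_all _ fun x => ?_)
    simp only [Pi.add_apply]
    ring
  exact ((h3.add (integrable_const _)).const_mul _).add
    (((integrable_const _).add (h4.div_const s)).const_mul _)

theorem integral_reflectionMajorant (ρ μ y : ℝ) {s : ℝ} (hs : 0 < s) :
    ∫ v, reflectionMajorant ρ μ y s v ∂gaussianReal 0 s.toNNReal
      = 2 * y ^ ρ * (1 / √(2 * Real.pi * s) + μ) + 2 * s ^ ((ρ - 1) / 2) * (2 + μ ^ 2 * s) := by
  have hs0 : s.toNNReal ≠ 0 := by simpa using hs
  have hsc : (s.toNNReal : ℝ) = s := Real.coe_toNNReal s hs.le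
  have h1 := integrable_id_gaussianReal 0 s.toNNReal
  have h2 := integrable_sq_gaussianReal 0 s.toNNReal
  have h3 : Integrable (fun x : ℝ => max x 0) (gaussianReal 0 s.toNNReal) := h1.pos_part
  have e : ∀ v : ℝ, reflectionMajorant ρ μ y s v =
      y ^ ρ * (2 / s) * max v 0 + (2 * s ^ ((ρ - 1) / 2) / s * v ^ 2 +
        (4 * s ^ ((ρ - 1) / 2) * μ * v +
          (y ^ ρ * 2 * μ + 2 * s ^ ((ρ - 1) / 2) * (1 + μ ^ 2 * s)))) := by
    intro v
    unfold reflectionMajorant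
    field_simp
    ring
  simp_rw [e]
  rw [integral_add (h3.const_mul _) ((h2.const_mul _).fun_add ((h1.const_mul _).fun_add
      (integrable_const _))), integral_add (h2.const_mul _) ((h1.const_mul _).fun_add
      (integrable_const _)), integral_add (h1.const_mul _) (integrable_const _),
    integral_const_mul _ fun v : ℝ => v, integral_id_gaussianReal]
  simp only [integral_const_mul, integral_const, integral_sq_gaussianReal_zero,
    integral_posPart_gaussianReal_zero hs0, hsc]
  simp only [probReal_univ, smul_eq_mul]
  have : 0 < √(2 * Real.pi * s) := by positivity
  field_simp
  ring

theorem mul_rpow_le_of_le_one {ρ s u : ℝ} (hρ0 : 0 < ρ) (hρ1 : ρ ≤ 1) (hs : 0 < s) (hu : 0 < u) :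
    u * u ^ ρ ≤ s * s ^ ((ρ - 1) / 2) * (1 + u ^ 2 / s) := by
  have hq : 0 < √s := Real.sqrt_pos.2 hs
  have hsq : √s ^ 2 = s := Real.sq_sqrt hs.le
  have hw : 0 < u / √s := by positivity
  have h1 : (u / √s) ^ (1 + ρ) ≤ 1 + (u / √s) ^ 2 := by
    rcases le_total (u / √s) 1 with h | h
    · have := Real.rpow_le_one hw.le h (by linarith : 0 ≤ 1 + ρ)
      nlinarith [sq_nonneg (u / √s)]
    · have := Real.rpow_le_rpow_of_exponent_le h (by linarith : 1 + ρ ≤ 2)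
      rw [Real.rpow_two] at this
      linarith
  have h2 : √s ^ (1 + ρ) = s * s ^ ((ρ - 1) / 2) := by
    rw [Real.sqrt_eq_rpow, ← Real.rpow_mul hs.le, ← Real.rpow_one_add' hs.le (by linarith)]
    congr 1
    ring
  have h3 : u * u ^ ρ = √s ^ (1 + ρ) * (u / √s) ^ (1 + ρ) := by
    rw [← Real.mul_rpow hq.le hw.le, mul_div_cancel₀ _ hq.ne',
      Real.rpow_one_add' hu.le (by linarith)]
  rw [h3, ← h2, ← hsq, ← div_pow, hsq]
  gcongr

theorem reflection_integrand_le {ρ μ y s m b : ℝ} (hρ0 : 0 < ρ) (hρ1 : ρ ≤ 1) (hμ : 0 ≤ μ)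
    (hs : 0 < s) (hm : 0 < m) (hmy : m < y) (hb : b < m) :
    (y - b) ^ ρ * Real.exp (-μ * b - μ ^ 2 * s / 2) *
        (2 * (2 * m - b) / (s * √(2 * Real.pi * s))) * Real.exp (-(2 * m - b) ^ 2 / (2 * s))
      ≤ gaussianPDFReal 0 s.toNNReal (2 * m - μ * s - b) *
        reflectionMajorant ρ μ y s (2 * m - μ * s - b) := by
  obtain ⟨u, rfl⟩ : ∃ u, b = 2 * m - u := ⟨2 * m - b, by ring⟩
  have hu : 0 < u := by linarith
  have hy : 0 < y := hm.trans hmy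
  have hpi : 0 < √(2 * Real.pi * s) := by positivity
  rw [gaussianPDFReal, Real.coe_toNNReal s hs.le]
  set E := Real.exp (-(2 * m - μ * s - (2 * m - u) - 0) ^ 2 / (2 * s)) with hE
  have hexp : Real.exp (-μ * (2 * m - u) - μ ^ 2 * s / 2) *
      Real.exp (-(2 * m - (2 * m - u)) ^ 2 / (2 * s)) ≤ E := by
    rw [← Real.exp_add, hE, Real.exp_le_exp]
    have : -(2 * m - μ * s - (2 * m - u) - 0) ^ 2 / (2 * s) =
        -μ * (2 * m - u) - μ ^ 2 * s / 2 + -(2 * m - (2 * m - u)) ^ 2 / (2 * s) + 2 * μ * m := by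
      field_simp
      ring
    rw [this]
    have := mul_nonneg hμ hm.le
    linarith
  have hpow : (y - (2 * m - u)) ^ ρ ≤ y ^ ρ + u ^ ρ :=
    (Real.rpow_le_rpow (by linarith) (by linarith) hρ0.le).trans
      (Real.rpow_add_le_add_rpow hy.le hu.le hρ0.le hρ1)
  have hmaj : (y ^ ρ + u ^ ρ) * (2 * u / s) ≤
      reflectionMajorant ρ μ y s (2 * m - μ * s - (2 * m - u)) := by
    have h1 := mul_rpow_le_of_le_one hρ0 hρ1 hs hu
    have h2 : u ≤ max (u - μ * s) 0 + μ * s := by linarith [le_max_left (u - μ * s) 0]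
    have e1 : 2 * m - μ * s - (2 * m - u) = u - μ * s := by ring
    rw [reflectionMajorant, e1, sub_add_cancel]
    calc (y ^ ρ + u ^ ρ) * (2 * u / s) = y ^ ρ * (2 / s) * u + 2 / s * (u * u ^ ρ) := by ring
      _ ≤ y ^ ρ * (2 / s) * (max (u - μ * s) 0 + μ * s) +
          2 / s * (s * s ^ ((ρ - 1) / 2) * (1 + u ^ 2 / s)) := by gcongr
      _ = _ := by field_simp
  calc _ = (√(2 * Real.pi * s))⁻¹ * (Real.exp (-μ * (2 * m - u) - μ ^ 2 * s / 2) *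
        Real.exp (-(2 * m - (2 * m - u)) ^ 2 / (2 * s))) *
          ((y - (2 * m - u)) ^ ρ * (2 * u / s)) := by
        field_simp
        ring
    _ ≤ (√(2 * Real.pi * s))⁻¹ * E * ((y ^ ρ + u ^ ρ) * (2 * u / s)) := by
        have : 0 ≤ (y - (2 * m - u)) ^ ρ := Real.rpow_nonneg (by linarith) _
        gcongr
    _ ≤ _ := by gcongr

/-- For all `ρ ∈ (0,1]`, `μ ≥ 0`, `y > 0` and `s > 0`,
`(1/y) ∫_{0}^{y} ∫_{-∞}^{m} (y-b)^ρ exp(-μ b - μ² s/2) (2(2m-b)/(s √(2π s))) exp(-(2m-b)²/(2s)) db dm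
  ≤ 2 y^ρ (1/√(2π s) + μ) + 2 s^{(ρ-1)/2} (2 + μ² s)`. -/
theorem stmt6 (ρ μ y s : ℝ) (hρ0 : 0 < ρ) (hρ1 : ρ ≤ 1) (hμ : 0 ≤ μ) (hy : 0 < y)
    (hs : 0 < s) :
    (1/y) * ∫ m in Set.Ioo (0:ℝ) y, ∫ b in Set.Iio m,
        (y - b) ^ ρ * Real.exp (-μ * b - μ^2 * s / 2) *
          (2 * (2*m - b) / (s * Real.sqrt (2 * Real.pi * s))) *
          Real.exp (-(2*m - b)^2 / (2*s))
      ≤ 2 * y ^ ρ * (1 / Real.sqrt (2 * Real.pi * s) + μ)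
        + 2 * s ^ ((ρ - 1)/2) * (2 + μ^2 * s) := by
  have hs0 : s.toNNReal ≠ 0 := by simpa using hs
  rw [← integral_reflectionMajorant ρ μ y hs]
  set C := ∫ v, reflectionMajorant ρ μ y s v ∂gaussianReal 0 s.toNNReal with hC
  have hint := (integrable_gaussianReal_iff hs0).1
    (integrable_reflectionMajorant ρ μ y s s.toNNReal)
  have hinner : ∀ m ∈ Ioo (0 : ℝ) y, ‖∫ b in Iio m, (y - b) ^ ρ *
      Real.exp (-μ * b - μ ^ 2 * s / 2) * (2 * (2 * m - b) / (s * √(2 * Real.pi * s))) *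
        Real.exp (-(2 * m - b) ^ 2 / (2 * s))‖ ≤ C := by
    rintro m ⟨hm, hmy⟩
    have hint' := hint.comp_sub_left (2 * m - μ * s)
    have hCm : C = ∫ b, gaussianPDFReal 0 s.toNNReal (2 * m - μ * s - b) *
        reflectionMajorant ρ μ y s (2 * m - μ * s - b) := by
      rw [hC, integral_gaussianReal_eq_integral_smul hs0]
      exact (integral_sub_left_eq_self (fun v => gaussianPDFReal 0 s.toNNReal v *
        reflectionMajorant ρ μ y s v) volume (2 * m - μ * s)).symm
    rw [hCm]
    refine (norm_integral_le_of_norm_le hint'.integrableOn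
      ((ae_restrict_iff' measurableSet_Iio).2 (ae_of_all _ fun b hb => ?_))).trans
      (setIntegral_le_integral hint' (ae_of_all _ fun b =>
        mul_nonneg (gaussianPDFReal_nonneg _ _ _) (reflectionMajorant_nonneg hμ hy hs _)))
    have hb' : b < m := hb
    have h1 : 0 ≤ (y - b) ^ ρ := Real.rpow_nonneg (by linarith) _
    have h2 : 0 ≤ 2 * m - b := by linarith
    rw [Real.norm_of_nonneg (by positivity)]
    exact reflection_integrand_le hρ0 hρ1 hμ hs hm hmy hb'
  have houter := (le_abs_self _).trans
    (norm_setIntegral_le_of_norm_le_const (measure_Ioo_lt_top (μ := volume)) hinner)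
  rw [Real.volume_real_Ioo_of_le hy.le, sub_zero] at houter
  rw [one_div, inv_mul_le_iff₀ hy, mul_comm y]
  exact houter
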